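/- arXiv:2407.20488 — 3 statements merged into one kernel-verified Lean document; each statement's English description precedes it below -/
import Mathlib

section
/- Let R be a commutative ring, let μ be a module measure on the category of R-modules, and let M be a minimally μ-big R-module. Then the annihilator Ann_R(M) of M in R is a prime ideal of R. -/
universe u

/-- A **module measure** on the category of left `R`-modules: a `{0,1}`-valued function
(`false` standing for `0` and `true` for `1`) on all left `R`-modules such that
(1) the zero module has measure `0`; (2) isomorphic modules have equal measures;
(3) if `μ(M) = 1` and `N ≤ M` has `μ(N) = 0`, then `μ(M/N) = 1`. -/
structure ModuleMeasure (R : Type u) [CommRing R] where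
  toFun : (M : Type u) → [AddCommGroup M] → [Module R M] → Bool
  measure_zero : ∀ (M : Type u) [AddCommGroup M] [Module R M],
    Subsingleton M → toFun M = false
  measure_iso : ∀ (M₁ : Type u) [AddCommGroup M₁] [Module R M₁]
    (M₂ : Type u) [AddCommGroup M₂] [Module R M₂],
    Nonempty (M₁ ≃ₗ[R] M₂) → toFun M₁ = toFun M₂
  measure_quot : ∀ (M : Type u) [AddCommGroup M] [Module R M] (N : Submodule R M),
    toFun M = true → toFun ↥N = false → toFun (M ⧸ N) = true

/-- A left `R`-module `M` is **minimally `μ`-big** if `μ(M) = 1` but `μ(N) = 0` for every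
proper submodule `N < M`. -/
def MinimallyMuBig {R : Type u} [CommRing R] (μ : ModuleMeasure R)
    (M : Type u) [AddCommGroup M] [Module R M] : Prop :=
  μ.toFun M = true ∧ ∀ N : Submodule R M, N < ⊤ → μ.toFun ↥N = false


/-- **Proposition 1 (first part).** Let `R` be a commutative ring, `μ` a module measure on
`R`-mod, and `M` a minimally `μ`-big `R`-module. Then `Ann_R(M)` is a prime ideal of `R`. -/
theorem minimallyMuBig_annihilator_isPrime {R : Type u} [CommRing R] (μ : ModuleMeasure R)
    (M : Type u) [AddCommGroup M] [Module R M] (hM : MinimallyMuBig μ M) :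
    (Module.annihilator R M).IsPrime := by
  obtain ⟨h1, h2⟩ := hM
  have key : ∀ r : R, r ∉ Module.annihilator R M → ∀ m : M, ∃ n : M, r • n = m := by
    intro r hr
    let f : M →ₗ[R] M := LinearMap.lsmul R M r
    have hk : LinearMap.ker f < ⊤ := by
      rw [lt_top_iff_ne_top]
      intro h
      apply hr
      rw [Module.mem_annihilator]
      intro m
      have hm : m ∈ LinearMap.ker f := by rw [h]; trivial
      exact hm
    have hq := μ.measure_quot M _ h1 (h2 _ hk)
    rw [μ.measure_iso _ _ ⟨f.quotKerEquivRange⟩] at hq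
    have ht : LinearMap.range f = ⊤ := by
      by_contra hne
      have h0 := h2 _ (lt_top_iff_ne_top.mpr hne)
      rw [hq] at h0
      exact absurd h0 (by decide)
    intro m
    have hm : m ∈ LinearMap.range f := by rw [ht]; trivial
    exact hm
  refine ⟨?_, ?_⟩
  · intro h
    have hs : Subsingleton M := Module.annihilator_eq_top_iff.mp h
    rw [μ.measure_zero M hs] at h1
    exact absurd h1 (by decide)
  · intro a b hab
    by_contra hcon
    rw [not_or] at hcon
    apply hcon.2
    rw [Module.mem_annihilator] at hab ⊢
    intro m
    obtain ⟨n, rfl⟩ := key a hcon.1 m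
    rw [smul_smul, mul_comm]
    exact hab n
end

section
/- Let R be a commutative ring, let μ be a module measure on the category of R-modules, and let M be a minimally μ-big R-module. If the annihilator Ann_R(M) is a maximal ideal of R, then M is a simple R-module. -/
universe u

/-- **Proposition 1 (second part).** Let `R` be a commutative ring, `μ` a module measure on
`R`-mod, and `M` a minimally `μ`-big `R`-module. If `Ann_R(M)` is a maximal ideal of `R`,
then `M` is a simple `R`-module. -/
theorem minimallyMuBig_isSimpleModule_of_annihilator_isMaximal {R : Type u} [CommRing R]
    (μ : ModuleMeasure R) (M : Type u) [AddCommGroup M] [Module R M]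
    (hM : MinimallyMuBig μ M) (hAnn : (Module.annihilator R M).IsMaximal) :
    IsSimpleModule R M := by
  have ht : Module.IsTorsionBySet R M (Module.annihilator R M : Set R) :=
    Module.isTorsionBySet_annihilator R M
  letI : Field (R ⧸ Module.annihilator R M) := Ideal.Quotient.field _
  letI : Module (R ⧸ Module.annihilator R M) M := ht.module
  have hs : IsSemisimpleModule R M := ht.isSemisimpleModule_iff.mp inferInstance
  have hnt : Nontrivial M := by
    by_contra h
    have := μ.measure_zero M (not_nontrivial_iff_subsingleton.mp h)
    simp [hM.1] at this
  have : IsSimpleOrder (Submodule R M) := by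
    refine { eq_bot_or_eq_top := fun N => ?_ }
    by_contra! h
    obtain ⟨C, hC⟩ := exists_isCompl N
    have h1 := μ.measure_quot M N hM.1 (hM.2 N (lt_top_iff_ne_top.mpr h.2))
    have h2 := μ.measure_iso _ _ ⟨Submodule.quotientEquivOfIsCompl N C hC⟩
    have h3 : C ≠ ⊤ := by
      rintro rfl
      exact h.1 (by simpa using hC.inf_eq_bot)
    rw [h1, hM.2 C (lt_top_iff_ne_top.mpr h3)] at h2
    cases h2
  exact (isSimpleModule_iff R M).mpr this
end

section
/- Let R be a commutative ring, let μ be a sum-small module measure on the category of R-modules, and let M be an Artinian R-module that is minimally μ-big. Then M is a simple R-module. -/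
universe u

/-- A module measure `μ` is **sum-small** if for every `R`-module `M` and every countable
collection `S` of submodules of `M` each of measure `0`, the sum of the members of `S`
also has measure `0`. -/
def ModuleMeasure.SumSmall {R : Type u} [CommRing R] (μ : ModuleMeasure R) : Prop :=
  ∀ (M : Type u) [AddCommGroup M] [Module R M] (S : Set (Submodule R M)),
    S.Countable → (∀ N ∈ S, μ.toFun ↥N = false) → μ.toFun ↥(sSup S) = false

theorem ModuleMeasure.top_mem_of_sSup {R : Type u} [CommRing R]
    (μ : ModuleMeasure R) (hμ : μ.SumSmall) (M : Type u) [AddCommGroup M] [Module R M]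
    (hM : MinimallyMuBig μ M) (S : Set (Submodule R M)) (hS : S.Countable)
    (h : sSup S = ⊤) : ⊤ ∈ S := by
  by_contra hn
  have h1 := hμ M S hS (fun N hN => hM.2 N (lt_top_iff_ne_top.2 (fun e => hn (e ▸ hN))))
  rw [h, μ.measure_iso _ M ⟨Submodule.topEquiv⟩, hM.1] at h1
  exact absurd h1 (by simp)

theorem ModuleMeasure.kill_or_surj {R : Type u} [CommRing R]
    (μ : ModuleMeasure R) (M : Type u) [AddCommGroup M] [Module R M]
    (hM : MinimallyMuBig μ M) (r : R) :
    (∀ x : M, r • x = 0) ∨ Function.Surjective (fun x : M => r • x) := by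
  by_cases hk : LinearMap.ker (LinearMap.lsmul R M r) = ⊤
  · left
    intro x
    have : x ∈ LinearMap.ker (LinearMap.lsmul R M r) := hk ▸ Submodule.mem_top
    simpa using this
  · right
    have h1 := μ.measure_quot M _ hM.1 (hM.2 _ (lt_top_iff_ne_top.2 hk))
    rw [μ.measure_iso _ _ ⟨(LinearMap.lsmul R M r).quotKerEquivRange⟩] at h1
    have h2 : LinearMap.range (LinearMap.lsmul R M r) = ⊤ := by
      by_contra hne
      rw [hM.2 _ (lt_top_iff_ne_top.2 hne)] at h1
      exact absurd h1 (by simp)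
    exact LinearMap.range_eq_top.1 h2

/-- In an Artinian module, an element killing all simple submodules is locally nilpotent. -/
theorem exists_pow_smul_eq_zero_of_socle {R : Type u} [CommRing R]
    (M : Type u) [AddCommGroup M] [Module R M] [IsArtinian R M] (r : R)
    (hr : ∀ S : Submodule R M, IsSimpleModule R S → ∀ x ∈ S, r • x = 0) (x : M) :
    ∃ n : ℕ, r ^ n • x = 0 := by
  obtain ⟨n, y, hy⟩ := IsArtinian.exists_pow_succ_smul_dvd r
    (⟨x, Submodule.mem_span_singleton_self x⟩ : Submodule.span R {x})
  obtain ⟨y, hy'⟩ := y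
  obtain ⟨s, rfl⟩ := Submodule.mem_span_singleton.1 hy'
  have hy2 : r ^ (n + 1) • s • x = r ^ n • x := congrArg Subtype.val hy
  refine ⟨n, ?_⟩
  have hz : (1 - r * s) • (r ^ n • x) = 0 := by
    rw [sub_smul, one_smul, sub_eq_zero]
    refine hy2.symm.trans ?_
    simp only [smul_smul]
    congr 1
    ring
  rcases eq_bot_or_exists_atom_le (LinearMap.ker (LinearMap.lsmul R M (1 - r * s))) with h | ⟨S, hS, hle⟩
  · have : r ^ n • x ∈ LinearMap.ker (LinearMap.lsmul R M (1 - r * s)) := LinearMap.mem_ker.2 hz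
    rw [h] at this
    simpa using this
  · exfalso
    apply hS.1
    rw [eq_bot_iff]
    intro w hw
    have h1 : (1 - r * s) • w = 0 := LinearMap.mem_ker.1 (hle hw)
    have h2 := hr S (isSimpleModule_iff_isAtom.2 hS) w hw
    rw [sub_smul, mul_comm, mul_smul, h2] at h1
    simpa using h1

/-- **Proposition 2.** Let `R` be a commutative ring, `μ` a sum-small module measure on
`R`-mod, and `M` an Artinian minimally `μ`-big `R`-module. Then `M` is simple. -/
theorem artinian_minimallyMuBig_isSimpleModule {R : Type u} [CommRing R]
    (μ : ModuleMeasure R) (hμ : μ.SumSmall) (M : Type u) [AddCommGroup M] [Module R M]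
    [IsArtinian R M] (hM : MinimallyMuBig μ M) :
    IsSimpleModule R M := by
  have hnt : Nontrivial M := by
    by_contra h
    rw [not_nontrivial_iff_subsingleton] at h
    have h1 := μ.measure_zero M h
    rw [hM.1] at h1
    exact absurd h1 (by simp)
  have hks := μ.kill_or_surj M hM
  have hnot : ∀ r : R, Function.Surjective (fun x : M => r • x) → ¬ ∀ x : M, r • x = 0 := by
    intro r h1 h2
    obtain ⟨y, hy⟩ := exists_ne (0 : M)
    obtain ⟨x, hx⟩ := h1 y
    exact hy (hx.symm.trans (h2 x))
  have hprime : ∀ r s : R, (∀ x : M, (r * s) • x = 0) → (¬ ∀ x : M, r • x = 0) →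
      ∀ x : M, s • x = 0 := by
    intro r s h hr
    refine (hks s).resolve_right fun hs => hr fun x => ?_
    obtain ⟨y, rfl⟩ := hs x
    simpa [mul_smul] using h y
  have hprimepow : ∀ (r : R) (n : ℕ), (∀ x : M, r ^ n • x = 0) → ∀ x : M, r • x = 0 := by
    intro r n
    induction n with
    | zero =>
      intro h x
      have := h x
      rw [pow_zero, one_smul] at this
      rw [this, smul_zero]
    | succ n ih =>
      intro h
      by_cases h' : ∀ x : M, r ^ n • x = 0
      · exact ih h'
      · exact hprime _ _ (by simpa [pow_succ] using h) h'
  -- an element killing the socle kills `M`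
  have hsoc : ∀ r : R, (∀ S : Submodule R M, IsSimpleModule R S → ∀ x ∈ S, r • x = 0) →
      ∀ x : M, r • x = 0 := by
    intro r hr
    have hmem := μ.top_mem_of_sSup hμ M hM
      (Set.range fun n : ℕ => LinearMap.ker (LinearMap.lsmul R M (r ^ n)))
      (Set.countable_range _) (by
        rw [eq_top_iff]
        intro x _
        obtain ⟨n, hn⟩ := exists_pow_smul_eq_zero_of_socle M r hr x
        have hle := le_sSup (Set.mem_range_self
          (f := fun n : ℕ => LinearMap.ker (LinearMap.lsmul R M (r ^ n))) n)
        exact hle (LinearMap.mem_ker.2 hn))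
    obtain ⟨n, hn⟩ := hmem
    refine hprimepow r n fun x => ?_
    have hx : x ∈ LinearMap.ker (LinearMap.lsmul R M (r ^ n)) := by
      simp only at hn
      rw [hn]; trivial
    simpa using hx
  -- the annihilator is maximal
  have hmax : ∀ r : R, (¬ ∀ x : M, r • x = 0) → ∃ s : R, ∀ x : M, s • r • x = x := by
    intro r hr
    let soc : Submodule R M := ⨆ S ∈ {S : Submodule R M | IsSimpleModule R S}, S
    have hss : IsSemisimpleModule R soc :=
      isSemisimpleModule_biSup_of_isSemisimpleModule_submodule
        (p := fun S : Submodule R M => S) (fun S hS => by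
          have : IsSimpleModule R S := hS
          infer_instance)
    have hfin : Module.Finite R soc :=
      ((IsSemisimpleModule.finite_tfae (R := R) (M := soc)).out 0 2 :
        Module.Finite R soc ↔ IsArtinian R soc).2 inferInstance
    obtain ⟨t, ht⟩ := hfin.fg_top
    let f : R →ₗ[R] (t → soc) := LinearMap.pi fun i => LinearMap.toSpanSingleton R soc i.1
    have hf : ∀ a : R, f a = 0 → ∀ x : M, a • x = 0 := by
      intro a ha
      refine hsoc a fun S hS x hx => ?_
      have hle : (⊤ : Submodule R soc) ≤ LinearMap.ker (LinearMap.lsmul R soc a) := by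
        rw [← ht, Submodule.span_le]
        intro w hw
        have := congrFun ha ⟨w, hw⟩
        simpa [f] using this
      have hxs : x ∈ soc := (le_iSup₂_of_le (f := fun (S : Submodule R M)
        (_ : S ∈ {S : Submodule R M | IsSimpleModule R S}) => S) S hS le_rfl) hx
      have := hle (Submodule.mem_top (x := ⟨x, hxs⟩))
      have h2 : a • (⟨x, hxs⟩ : soc) = 0 := by simpa using this
      exact congrArg Subtype.val h2
    obtain ⟨n, ⟨_, y, rfl⟩, hy⟩ := IsArtinian.exists_pow_succ_smul_dvd r
      (⟨f 1, 1, rfl⟩ : LinearMap.range f)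
    have hy2 : r ^ (n + 1) • f y = r ^ n • f 1 := congrArg Subtype.val hy
    have h3 : f (r ^ n * (y * r - 1)) = 0 := by
      have : r ^ n * (y * r - 1) = r ^ (n + 1) • y - r ^ n • (1 : R) := by
        simp only [smul_eq_mul]; ring
      rw [this, map_sub, map_smul, map_smul, hy2, sub_self]
    have h4 := hprime _ _ (hf _ h3) (fun h => hr (hprimepow r n h))
    refine ⟨y, fun x => ?_⟩
    have := h4 x
    rwa [sub_smul, one_smul, sub_eq_zero, mul_smul] at this
  have hsimple : ∀ x : M, x ≠ 0 → IsSimpleModule R (Submodule.span R {x}) := by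
    intro x hx
    rw [isSimpleModule_iff_isAtom]
    refine ⟨by simpa using hx, fun N hN => ?_⟩
    by_contra hne
    obtain ⟨w, hw, hw0⟩ := N.ne_bot_iff.1 hne
    obtain ⟨a, rfl⟩ := Submodule.mem_span_singleton.1 (hN.le hw)
    obtain ⟨s, hs⟩ := hmax a (fun h => hw0 (h x))
    refine hN.not_ge ?_
    rw [Submodule.span_singleton_le_iff_mem, ← hs x]
    exact N.smul_mem s hw
  have hss : IsSemisimpleModule R M := by
    apply IsSemisimpleModule.of_sSup_simples_eq_top
    rw [eq_top_iff]
    intro x _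
    by_cases hx : x = 0
    · rw [hx]; exact Submodule.zero_mem _
    · have hle : Submodule.span R {x} ≤ sSup {m : Submodule R M | IsSimpleModule R m} :=
        le_sSup (hsimple x hx)
      exact hle (Submodule.mem_span_singleton_self x)
  obtain ⟨x, hx⟩ := exists_ne (0 : M)
  obtain ⟨C, hC⟩ := exists_isCompl (Submodule.span R {x})
  have hmem := μ.top_mem_of_sSup hμ M hM {Submodule.span R {x}, C} (Set.to_countable _)
    (by rw [sSup_pair]; exact hC.sup_eq_top)
  have hsx := hsimple x hx
  rcases hmem with h | h
  · rw [← h] at hsx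
    exact IsSimpleModule.congr (Submodule.topEquiv (R := R) (M := M)).symm
  · exfalso
    have h5 := hC.inf_eq_bot
    rw [← (show ⊤ = C from h), inf_top_eq] at h5
    exact hx (by simpa using h5)
end
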